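/- For a π-regular E-semigroup X the following conditions are equivalent: (1) ⇕e = √∞H_e for every idempotent e of X; (2) X is E-separated; (3) X is E-upcentral, E-hypocentral, and E-commutative. -/

import Mathlib

universe u

/-- The binary quasiorder `x ≲ y` on a semigroup `X`: `χ x ≤ χ y` for every semigroup
homomorphism `χ : X → 𝟐`, where the two-element semilattice `𝟐 = {0,1}` (with multiplication
inherited from `ℤ`) is represented by `Bool` (with `* = and`, `false ≤ true`). -/
def binLe {X : Type u} [Semigroup X] (x y : X) : Prop :=
  ∀ χ : X →ₙ* Bool, χ x ≤ χ y

/-- The `𝟐`-class `⇕a = {x | a ≲ x ≲ a}`. -/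
def twoClass {X : Type u} [Semigroup X] (a : X) : Set X :=
  {x | binLe a x ∧ binLe x a}

/-- The upper `𝟐`-class `⇑a = {x | a ≲ x}`. -/
def upClass {X : Type u} [Semigroup X] (a : X) : Set X :=
  {x | binLe a x}

/-- The `ℋ`-class of `e`: `{x ∈ X | xX¹ = eX¹ ∧ X¹x = X¹e}`, where `X¹ = WithOne X` is `X`
with an identity adjoined. For an idempotent `e` this is the maximal subgroup containing `e`. -/
def HClass {X : Type u} [Semigroup X] (e : X) : Set X :=
  {x | (Set.range fun z : WithOne X => (x : WithOne X) * z) =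
         (Set.range fun z : WithOne X => (e : WithOne X) * z) ∧
       (Set.range fun z : WithOne X => z * (x : WithOne X)) =
         (Set.range fun z : WithOne X => z * (e : WithOne X))}

/-- `spow x n = x^(n+1)`: the positive powers of an element of a semigroup. -/
def spow {X : Type u} [Semigroup X] (x : X) : ℕ → X
  | 0 => x
  | n + 1 => spow x n * x

/-- `rootInf A = √∞A = {x | x^n ∈ A for some positive integer n}`. -/
def rootInf {X : Type u} [Semigroup X] (A : Set X) : Set X :=
  {x | ∃ n : ℕ, spow x n ∈ A}

/-- `I` is an ideal of the semigroup `X`: `IX ∪ XI ⊆ I`. -/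
def IsIdealSet {X : Type u} [Semigroup X] (I : Set X) : Prop :=
  ∀ a ∈ I, ∀ x : X, a * x ∈ I ∧ x * a ∈ I

/-- A prime coideal: the complement is an ideal and the set itself is a subsemigroup. -/
def IsPrimeCoideal {X : Type u} [Semigroup X] (C : Set X) : Prop :=
  IsIdealSet Cᶜ ∧ ∀ a b : X, a ∈ C → b ∈ C → a * b ∈ C

/-- A semigroup is `𝟐`-trivial if every homomorphism to the two-element semilattice
`𝟐` is constant. -/
def TwoTrivial (X : Type u) [Semigroup X] : Prop :=
  ∀ χ : X →ₙ* Bool, ∀ a b : X, χ a = χ b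

/-- `X` is `E`-separated: distinct idempotents are separated by a homomorphism to a
semilattice (a commutative semigroup of idempotents). -/
def ESeparated (X : Type u) [Semigroup X] : Prop :=
  ∀ x y : X, x * x = x → y * y = y → x ≠ y →
    ∃ (Y : Type u) (mul : Y → Y → Y) (h : X → Y),
      (∀ a b c : Y, mul (mul a b) c = mul a (mul b c)) ∧
      (∀ a b : Y, mul a b = mul b a) ∧
      (∀ a : Y, mul a a = a) ∧
      (∀ a b : X, h (a * b) = mul (h a) (h b)) ∧
      h x ≠ h y

/-- `X` is duo: `xX = Xx` for every `x ∈ X`. -/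
def IsDuo (X : Type u) [Semigroup X] : Prop :=
  ∀ x : X, (Set.range fun a : X => x * a) = (Set.range fun a : X => a * x)

/-- `X` is viable: whenever `xy` and `yx` are both idempotents, `xy = yx`. -/
def Viable (X : Type u) [Semigroup X] : Prop :=
  ∀ x y : X, (x * y) * (x * y) = x * y → (y * x) * (y * x) = y * x → x * y = y * x

/-- `H_e/e = {x ∈ X | xe = ex ∈ H_e}`. -/
def HeOverE {X : Type u} [Semigroup X] (e : X) : Set X :=
  {x | x * e = e * x ∧ e * x ∈ HClass e}

/-- `X` is `E`-viable: `H_e/e` is a coideal for every idempotent `e`. -/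
def EViable (X : Type u) [Semigroup X] : Prop :=
  ∀ e : X, e * e = e → IsIdealSet (HeOverE e)ᶜ

/-- `X` is `E⇑`-central: `ex = xe` for every idempotent `e` and every `x ∈ ⇑e`. -/
def EUpArrowCentral (X : Type u) [Semigroup X] : Prop :=
  ∀ e : X, e * e = e → ∀ x ∈ upClass e, e * x = x * e

/-- `X` is `E`-hypercentral. -/
def EHypercentral (X : Type u) [Semigroup X] : Prop :=
  ∀ e x y : X, e * e = e → x * y = e → x * e = e * x ∧ y * e = e * y

/-- `X` is `E`-hypocentral. -/
def EHypocentral (X : Type u) [Semigroup X] : Prop :=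
  ∀ e x y : X, e * e = e → x * y = e → x * e = e * x ∨ y * e = e * y

/-- `X` is `E`-upcentral. -/
def EUpcentral (X : Type u) [Semigroup X] : Prop :=
  ∀ e f : X, e * e = e → f * f = f → f * e = e → e * f = e →
    ∀ x ∈ rootInf (HClass f), x * e = e * x

/-- `X` is `E`-commutative: idempotents commute. -/
def ECommutative (X : Type u) [Semigroup X] : Prop :=
  ∀ e f : X, e * e = e → f * f = f → e * f = f * e

/-- The Clifford part `H(X) = ⋃_{e ∈ E(X)} H_e`. -/
def CliffordPart (X : Type u) [Semigroup X] : Set X :=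
  {x | ∃ e : X, e * e = e ∧ x ∈ HClass e}

def GrpAt {X : Type u} [Semigroup X] (e x : X) : Prop :=
  ∃ y, x * y = e ∧ y * x = e ∧ e * x = x ∧ x * e = x ∧ e * y = y ∧ y * e = y

theorem mem_HClass_iff {X : Type u} [Semigroup X] {e x : X} (he : e * e = e) :
    x ∈ HClass e ↔ GrpAt e x := by
  constructor
  · rintro ⟨h1, h2⟩
    have hx1 : e * x = x := by
      have : (x : WithOne X) ∈ Set.range fun z : WithOne X => (e : WithOne X) * z := by
        rw [← h1]; exact ⟨1, mul_one _⟩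
      obtain ⟨z, hz⟩ := this
      have h : (e : WithOne X) * x = x := by
        rw [← hz]
        simp only
        rw [← mul_assoc, ← WithOne.coe_mul, he]
      exact_mod_cast h
    have hx2 : x * e = x := by
      have : (x : WithOne X) ∈ Set.range fun z : WithOne X => z * (e : WithOne X) := by
        rw [← h2]; exact ⟨1, one_mul _⟩
      obtain ⟨z, hz⟩ := this
      have h : (x : WithOne X) * e = x := by
        rw [← hz]
        simp only
        rw [mul_assoc, ← WithOne.coe_mul, he]
      exact_mod_cast h
    have hu : ∃ u : X, x * u = e := by
      have : (e : WithOne X) ∈ Set.range fun z : WithOne X => (x : WithOne X) * z := by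
        rw [h1]; exact ⟨1, mul_one _⟩
      obtain ⟨z, hz⟩ := this
      cases z with
      | one =>
        have h : x = e := by simpa using hz
        exact ⟨e, by rw [h, he]⟩
      | coe u => exact ⟨u, by beta_reduce at hz; exact_mod_cast hz⟩
    have hw : ∃ w : X, w * x = e := by
      have : (e : WithOne X) ∈ Set.range fun z : WithOne X => z * (x : WithOne X) := by
        rw [h2]; exact ⟨1, one_mul _⟩
      obtain ⟨z, hz⟩ := this
      cases z with
      | one =>
        have h : x = e := by simpa using hz
        exact ⟨e, by rw [h, he]⟩
      | coe u => exact ⟨u, by beta_reduce at hz; exact_mod_cast hz⟩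
    obtain ⟨u, hu⟩ := hu
    obtain ⟨w, hw⟩ := hw
    have hy : e * u = w * e := by rw [← hu, ← mul_assoc, hw, hu]
    refine ⟨e * u, ?_, ?_, hx1, hx2, ?_, ?_⟩
    · rw [← mul_assoc, hx2, hu]
    · rw [hy, mul_assoc, hx1, hw]
    · rw [← mul_assoc, he]
    · rw [hy, mul_assoc, he]
  · rintro ⟨y, h1, h2, h3, h4, h5, h6⟩
    constructor
    · ext t
      constructor
      · rintro ⟨z, rfl⟩
        exact ⟨x * z, by simp only; rw [← mul_assoc, ← WithOne.coe_mul, h3]⟩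
      · rintro ⟨z, rfl⟩
        exact ⟨y * z, by simp only; rw [← mul_assoc, ← WithOne.coe_mul, h1]⟩
    · ext t
      constructor
      · rintro ⟨z, rfl⟩
        exact ⟨z * x, by simp only; rw [mul_assoc, ← WithOne.coe_mul, h4]⟩
      · rintro ⟨z, rfl⟩
        exact ⟨z * y, by simp only; rw [mul_assoc, ← WithOne.coe_mul, h2]⟩

theorem spow_comm {X : Type u} [Semigroup X] (x : X) (n : ℕ) : x * spow x n = spow x n * x := by
  induction n with
  | zero => rfl
  | succ n ih => simp only [spow]; rw [← mul_assoc, ih]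

theorem spow_hom {X Y : Type u} [Semigroup X] [Semigroup Y] (hi : ∀ y : Y, y * y = y)
    (h : X →ₙ* Y) (x : X) (n : ℕ) : h (spow x n) = h x := by
  induction n with
  | zero => rfl
  | succ n ih => simp only [spow]; rw [map_mul, ih, hi]

theorem spow_bool {X : Type u} [Semigroup X]
    (h : X →ₙ* Bool) (x : X) (n : ℕ) : h (spow x n) = h x := by
  induction n with
  | zero => rfl
  | succ n ih => simp only [spow]; rw [map_mul, ih]; generalize h x = b; revert b; decide

/-- inverse-like element for an element of the root of `H_f` -/
theorem root_inv {X : Type u} [Semigroup X] {f x : X} (hf : f * f = f)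
    (hx : x ∈ rootInf (HClass f)) : ∃ v, x * v = f ∧ v * x = f := by
  obtain ⟨n, hn⟩ := hx
  obtain ⟨y, h1, h2, h3, h4, h5, h6⟩ := (mem_HClass_iff hf).1 hn
  have hc := spow_comm x n
  have hfx : f * x = x * f := by
    have e1 : f * x = f * x * f := by
      calc f * x = y * (spow x n * x) := by rw [← h2, mul_assoc]
        _ = y * (x * (spow x n * f)) := by rw [h4, hc]
        _ = y * (spow x n * x) * f := by rw [← hc]; simp only [mul_assoc]
        _ = f * x * f := by rw [← h2]; simp only [mul_assoc]
    have e2 : x * f = f * x * f := by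
      calc x * f = (x * spow x n) * y := by rw [← h1, mul_assoc]
        _ = ((f * spow x n) * x) * y := by rw [h3, hc]
        _ = f * (x * spow x n) * y := by rw [hc]; simp only [mul_assoc]
        _ = f * x * f := by rw [← h1]; simp only [mul_assoc]
    rw [e1, ← e2]
  obtain ⟨w1, w2, hw1, hw2⟩ : ∃ w1 w2, x * w1 = f ∧ w2 * x = f := by
    cases n with
    | zero => exact ⟨y, y, h1, h2⟩
    | succ n =>
      refine ⟨spow x n * y, y * spow x n, ?_, ?_⟩
      · rw [← mul_assoc, spow_comm]; exact h1
      · rw [mul_assoc]; exact h2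
  refine ⟨f * w1, ?_, ?_⟩
  · rw [← mul_assoc, ← hfx, mul_assoc, hw1, hf]
  · rw [show f * w1 = w2 * f by rw [← hw1, ← mul_assoc, hw2, hw1], mul_assoc, hfx, ← mul_assoc,
      hw2, hf]

theorem sep_eq {X : Type u} [Semigroup X] (hs : ESeparated X) {a b : X} (ha : a * a = a)
    (hb : b * b = b)
    (hab : ∀ (Y : Type u) [CommSemigroup Y], (∀ y : Y, y * y = y) → ∀ h : X →ₙ* Y, h a = h b) :
    a = b := by
  by_contra hne
  obtain ⟨Y, mul, h, as, co, id, hm, hh⟩ := hs a b ha hb hne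
  letI : CommSemigroup Y := { mul := mul, mul_assoc := as, mul_comm := co }
  exact hh (hab Y id ⟨h, hm⟩)

theorem two_three {X : Type u} [Semigroup X]
    (hE : ∀ e f : X, e * e = e → f * f = f → (e * f) * (e * f) = e * f) (hs : ESeparated X) :
    EUpcentral X ∧ EHypocentral X ∧ ECommutative X := by
  refine ⟨?_, ?_, ?_⟩
  · intro e f he hf hfe hef x hx
    obtain ⟨v, h1, h2⟩ := root_inv hf hx
    have hp : x * e * v * (x * e * v) = x * e * v := by
      calc x * e * v * (x * e * v) = x * (e * (v * x)) * e * v := by simp only [mul_assoc]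
        _ = x * e * v := by rw [h2, hef, mul_assoc x e e, he]
    have key : x * e * v = e := by
      apply sep_eq hs hp he
      intro Y _ hi h
      rw [map_mul, map_mul, mul_right_comm, ← map_mul, ← map_mul, h1, hfe]
    calc x * e = x * (e * (v * x)) := by rw [h2, hef]
      _ = x * e * v * x := by simp only [mul_assoc]
      _ = e * x := by rw [key]
  · intro e x y he hxy
    left
    have hp : y * e * x * (y * e * x) = y * e * x := by
      calc y * e * x * (y * e * x) = y * (e * (x * y) * e) * x := by simp only [mul_assoc]
        _ = y * e * x := by rw [hxy, he, he]
    have key : y * e * x = e := by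
      apply sep_eq hs hp he
      intro Y _ hi h
      have : h x * h y = h e := by rw [← map_mul, hxy]
      rw [map_mul, map_mul, mul_right_comm, mul_comm (h y), this, hi]
    calc x * e = x * (y * e * x) := by rw [key]
      _ = (x * y) * e * x := by simp only [mul_assoc]
      _ = e * x := by rw [hxy, he]
  · intro e f he hf
    apply sep_eq hs (hE e f he hf) (hE f e hf he)
    intro Y _ hi h
    rw [map_mul, map_mul, mul_comm]

theorem inv_comm {X : Type u} [Semigroup X] (hh : EHypocentral X) (hc : ECommutative X)
    {a y : X} (h1 : a * y * a = a) (h2 : y * a * y = y) : a * y = y * a := by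
  have half : ∀ a y : X, a * y * a = a → y * a * y = y → y * a = (a * y) * (y * a) := by
    intro a y h1 h2
    have he : a * y * (a * y) = a * y := by rw [← mul_assoc, h1]
    have hf : y * a * (y * a) = y * a := by rw [← mul_assoc, h2]
    rcases hh _ a y he rfl with h | h
    · rw [hc _ _ he hf]
      have : a * (a * y) = a := by rw [h, h1]
      rw [mul_assoc y a (a * y), this]
    · have : a * y * y = y := by rw [← h, ← mul_assoc, h2]
      rw [← mul_assoc (a * y), this]
  have he : a * y * (a * y) = a * y := by rw [← mul_assoc, h1]
  have hf : y * a * (y * a) = y * a := by rw [← mul_assoc, h2]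
  rw [half a y h1 h2, hc _ _ he hf, ← half y a h2 h1]

theorem exists_root {X : Type u} [Semigroup X]
    (hreg : ∀ x : X, ∃ (n : ℕ) (y : X), spow x n = spow x n * y * spow x n)
    (hh : EHypocentral X) (hc : ECommutative X) (x : X) :
    ∃ (e : X) (n : ℕ), e * e = e ∧ GrpAt e (spow x n) := by
  obtain ⟨n, z, hz⟩ := hreg x
  generalize ha : spow x n = a at hz
  have h1 : a * (z * a * z) * a = a := by
    calc a * (z * a * z) * a = (a * z * a) * z * a := by simp only [mul_assoc]
      _ = a := by rw [← hz, ← hz]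
  have h2 : (z * a * z) * a * (z * a * z) = z * a * z := by
    calc (z * a * z) * a * (z * a * z) = z * ((a * z * a) * z * a) * z := by
          simp only [mul_assoc]
      _ = z * a * z := by rw [← hz, ← hz]
  have h3 := inv_comm hh hc h1 h2
  generalize z * a * z = y at h1 h2 h3
  refine ⟨a * y, n, ?_, ?_⟩
  · rw [← mul_assoc, h1]
  · rw [ha]
    refine ⟨y, rfl, h3.symm, h1, ?_, ?_, ?_⟩
    · rw [h3, ← mul_assoc, h1]
    · rw [h3, h2]
    · rw [← mul_assoc, h2]

def Cset {X : Type u} [Semigroup X] (e x : X) : Prop := x * e = e * x ∧ GrpAt e (e * x)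

theorem grp_mul {X : Type u} [Semigroup X] {e a b : X} (ha : GrpAt e a) (hb : GrpAt e b) :
    GrpAt e (a * b) := by
  obtain ⟨y, h1, h2, h3, h4, h5, h6⟩ := ha
  obtain ⟨z, k1, k2, k3, k4, k5, k6⟩ := hb
  refine ⟨z * y, ?_, ?_, ?_, ?_, ?_, ?_⟩
  · rw [mul_assoc, ← mul_assoc b, k1, h5, h1]
  · rw [mul_assoc, ← mul_assoc y, h2, k3, k2]
  · rw [← mul_assoc, h3]
  · rw [mul_assoc, k4]
  · rw [← mul_assoc, k5]
  · rw [mul_assoc, h6]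

theorem grp_idem {X : Type u} [Semigroup X] {e a : X} (ha : GrpAt e a) (h : a * a = a) :
    a = e := by
  obtain ⟨y, h1, h2, h3, h4, h5, h6⟩ := ha
  calc a = a * (a * y) := by rw [h1, h4]
    _ = e := by rw [← mul_assoc, h, h1]

theorem cset_mul {X : Type u} [Semigroup X] {e x y : X} (hx : Cset e x)
    (hy : Cset e y) : Cset e (x * y) := by
  refine ⟨?_, ?_⟩
  · rw [mul_assoc, hy.1, ← mul_assoc, hx.1, mul_assoc]
  · have := grp_mul hx.2 hy.2
    obtain ⟨_, _, _, _, h4, _⟩ := hx.2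
    rwa [← mul_assoc, h4, mul_assoc] at this

theorem left_C {X : Type u} [Semigroup X]
    (hreg : ∀ x : X, ∃ (n : ℕ) (y : X), spow x n = spow x n * y * spow x n)
    (hu : EUpcentral X) (hh : EHypocentral X) (hc : ECommutative X) {e a : X} (he : e * e = e)
    (ha : GrpAt e (e * a)) : Cset e a := by
  refine ⟨?_, ha⟩
  obtain ⟨q, n, hq, hn⟩ := exists_root hreg hh hc a
  have hea : e * a * e = e * a := ha.choose_spec.2.2.2.1
  have hp : ∀ m, GrpAt e (e * spow a m) := by
    intro m
    induction m with
    | zero => exact ha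
    | succ m ih =>
      have := grp_mul ih ha
      obtain ⟨_, _, _, _, h4, _⟩ := ih
      rwa [← mul_assoc, h4, mul_assoc] at this
  obtain ⟨k, _, hk, _⟩ := hp n
  have hqa : spow a n * q = spow a n := hn.choose_spec.2.2.2.1
  have heq : e * q = e := by
    rw [← hk, mul_assoc, mul_assoc, hqa]
  exact hu e q he hq (by rw [hc q e hq he, heq]) heq a ⟨n, (mem_HClass_iff hq).2 hn⟩

theorem right_C {X : Type u} [Semigroup X]
    (hreg : ∀ x : X, ∃ (n : ℕ) (y : X), spow x n = spow x n * y * spow x n)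
    (hu : EUpcentral X) (hh : EHypocentral X) (hc : ECommutative X) {e a : X} (he : e * e = e)
    (ha : GrpAt e (a * e)) : Cset e a := by
  obtain ⟨q, n, hq, hn⟩ := exists_root hreg hh hc a
  have hea : e * (a * e) = a * e := ha.choose_spec.2.2.1
  have hp : ∀ m, GrpAt e (spow a m * e) := by
    intro m
    induction m with
    | zero => exact ha
    | succ m ih =>
      have := grp_mul ih ha
      rwa [mul_assoc, hea, ← mul_assoc] at this
  obtain ⟨k, hk, _⟩ := hp n
  have hqa : q * spow a n = spow a n := hn.choose_spec.2.2.1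
  have heq : q * e = e := by
    rw [← hk, ← mul_assoc, ← mul_assoc, hqa]
  have := hu e q he hq heq (by rw [hc e q he hq, heq]) a ⟨n, (mem_HClass_iff hq).2 hn⟩
  exact ⟨this, this ▸ ha⟩

theorem inv_grp {X : Type u} [Semigroup X] (hh : EHypocentral X) (hc : ECommutative X)
    {a b : X} (h1 : a * b * a = a) (h2 : b * a * b = b) :
    GrpAt (a * b) a ∧ GrpAt (a * b) b := by
  have h3 := inv_comm hh hc h1 h2
  have h4 : a * (a * b) = a := by rw [h3, ← mul_assoc, h1]
  have h5 : a * b * b = b := by rw [h3, h2]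
  have h6 : b * (a * b) = b := by rw [← mul_assoc, h2]
  exact ⟨⟨b, rfl, h3.symm, h1, h4, h5, h6⟩, ⟨a, h3.symm, rfl, h5, h6, h1, h4⟩⟩

theorem cset_coideal {X : Type u} [Semigroup X]
    (hreg : ∀ x : X, ∃ (n : ℕ) (y : X), spow x n = spow x n * y * spow x n)
    (hu : EUpcentral X) (hh : EHypocentral X) (hc : ECommutative X) {e x y : X} (he : e * e = e)
    (hxy : Cset e (x * y)) : Cset e x ∧ Cset e y := by
  obtain ⟨hcm, g, h1, h2, h3, h4, h5, h6⟩ := hxy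
  constructor
  · apply left_C hreg hu hh hc he
    have hab : (e * x) * (y * g) = e := by
      simp only [mul_assoc] at h1 ⊢; exact h1
    have := inv_grp (a := e * x) (b := y * g) hh hc (by rw [hab, ← mul_assoc, he])
      (by rw [mul_assoc, hab, mul_assoc, h6])
    rw [hab] at this
    exact this.1
  · apply right_C hreg hu hh hc he
    have hab : (g * x) * (y * e) = e := by
      calc (g * x) * (y * e) = g * (x * y * e) := by simp only [mul_assoc]
        _ = e := by rw [hcm, h2]
    have := inv_grp (a := g * x) (b := y * e) hh hc (by rw [hab, ← mul_assoc, h5])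
      (by rw [mul_assoc, hab, mul_assoc, he])
    rw [hab] at this
    exact this.2

theorem le_of_binLe {X : Type u} [Semigroup X]
    (hreg : ∀ x : X, ∃ (n : ℕ) (y : X), spow x n = spow x n * y * spow x n)
    (hE : ∀ e f : X, e * e = e → f * f = f → (e * f) * (e * f) = e * f)
    (hu : EUpcentral X) (hh : EHypocentral X) (hc : ECommutative X) {e f : X} (he : e * e = e)
    (hf : f * f = f) (hle : binLe e f) : e * f = e := by
  classical
  let χ : X →ₙ* Bool := ⟨fun x => decide (Cset e x), by
    intro x y
    have : ∀ a b : Bool, a * b = (a && b) := by decide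
    rw [this, ← Bool.decide_and, decide_eq_decide]
    exact ⟨cset_coideal hreg hu hh hc he, fun h => cset_mul h.1 h.2⟩⟩
  have h1 : χ e = true := by
    show decide (Cset e e) = true
    rw [decide_eq_true_iff]
    exact ⟨rfl, e, by simp only [he, and_self]⟩
  have h2 : χ f = true := by
    have := hle χ
    rw [h1] at this
    exact top_le_iff.1 this
  have h3 : Cset e f := of_decide_eq_true h2
  exact grp_idem h3.2 (hE e f he hf)

theorem grp_hom {X : Type u} [Semigroup X] {e x : X} (h : GrpAt e x) (χ : X →ₙ* Bool) :
    χ x = χ e := by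
  obtain ⟨y, h1, h2, h3, -⟩ := h
  have k1 : χ x * χ y = χ e := by rw [← map_mul, h1]
  have k3 : χ e * χ x = χ x := by rw [← map_mul, h3]
  revert k1 k3
  generalize χ x = a
  generalize χ y = b
  generalize χ e = c
  revert a b c
  decide

/-- For a `π`-regular `E`-semigroup `X` the following are equivalent:
(1) `⇕e = √∞H_e` for every idempotent `e`; (2) `X` is `E`-separated;
(3) `X` is `E`-upcentral, `E`-hypocentral and `E`-commutative. -/
theorem stmt_19 {X : Type u} [Semigroup X]
    (hreg : ∀ x : X, ∃ (n : ℕ) (y : X), spow x n = spow x n * y * spow x n)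
    (hE : ∀ e f : X, e * e = e → f * f = f → (e * f) * (e * f) = e * f) :
    List.TFAE [∀ e : X, e * e = e → twoClass e = rootInf (HClass e),
      ESeparated X,
      EUpcentral X ∧ EHypocentral X ∧ ECommutative X] := by
  tfae_have 1 → 2 := by
    intro h e f he hf hne
    by_contra hcon
    apply hne
    have hall : ∀ χ : X →ₙ* Bool, χ e = χ f := by
      intro χ
      by_contra hχ
      apply hcon
      have hb : ∀ a b c : Bool, a * b * c = a * (b * c) := by decide
      have hb2 : ∀ a b : Bool, a * b = b * a := by decide
      have hb3 : ∀ a : Bool, a * a = a := by decide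
      refine ⟨ULift Bool, fun a b => ⟨a.down * b.down⟩, fun x => ⟨χ x⟩, ?_, ?_, ?_, ?_, ?_⟩
      · intro a b c; exact congrArg ULift.up (hb _ _ _)
      · intro a b; exact congrArg ULift.up (hb2 _ _)
      · intro a; exact congrArg ULift.up (hb3 _)
      · intro a b; exact congrArg ULift.up (map_mul χ a b)
      · intro hx; exact hχ (congrArg ULift.down hx)
    have hmem : f ∈ twoClass e := ⟨fun χ => (hall χ).le, fun χ => (hall χ).ge⟩
    rw [h e he] at hmem
    obtain ⟨n, hn⟩ := hmem
    have hfn : ∀ n, spow f n = f := by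
      intro n
      induction n with
      | zero => rfl
      | succ n ih => simp only [spow]; rw [ih, hf]
    rw [hfn] at hn
    exact (grp_idem ((mem_HClass_iff he).1 hn) hf).symm
  tfae_have 2 → 3 := two_three hE
  tfae_have 3 → 1 := by
    rintro ⟨hu, hh, hc⟩ e he
    ext x
    constructor
    · rintro ⟨h1, h2⟩
      obtain ⟨f, n, hf, hn⟩ := exists_root hreg hh hc x
      have hx : ∀ χ : X →ₙ* Bool, χ x = χ f := fun χ => by
        rw [← spow_bool χ x n, grp_hom hn χ]
      have k1 := le_of_binLe hreg hE hu hh hc he hf (fun χ => by rw [← hx]; exact h1 χ)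
      have k2 := le_of_binLe hreg hE hu hh hc hf he (fun χ => by rw [← hx]; exact h2 χ)
      have : e = f := by rw [← k1, hc e f he hf, k2]
      subst this
      exact ⟨n, (mem_HClass_iff he).2 hn⟩
    · rintro ⟨n, hn⟩
      have hx : ∀ χ : X →ₙ* Bool, χ x = χ e := fun χ => by
        rw [← spow_bool χ x n, grp_hom ((mem_HClass_iff he).1 hn) χ]
      exact ⟨fun χ => (hx χ).ge, fun χ => (hx χ).le⟩
  tfae_finish
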